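/- For each γ ∈ (0,1), the function R ↦ I_{0,γ}(R) / R^{2−γ} is monotone non-increasing on (0, ∞). -/

import Mathlib

open MeasureTheory

/-- Modified Bessel function of the second kind:
`K_ν(x) = ∫₀^∞ exp(−x cosh s) cosh(ν s) ds` (so `K_{−ν} = K_ν`). -/
noncomputable def besselK (ν x : ℝ) : ℝ :=
  ∫ s in Set.Ioi (0 : ℝ), Real.exp (-x * Real.cosh s) * Real.cosh (ν * s)

/-- Modified Bessel function of the first kind:
`I_ν(x) = Σ_{j≥0} (x/2)^{2j+ν}/(j! Γ(ν+j+1))`. -/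
noncomputable def besselI (ν x : ℝ) : ℝ :=
  ∑' j : ℕ, (x / 2) ^ (2 * (j : ℝ) + ν) / ((j.factorial : ℝ) * Real.Gamma (ν + j + 1))

/-- Normalizing constant `C(3,γ) = 2^{2γ} Γ(3/2+γ)/(π^{3/2} |Γ(−γ)|)`. -/
noncomputable def C3 (γ : ℝ) : ℝ :=
  2 ^ (2 * γ) * Real.Gamma (3 / 2 + γ) / (Real.pi ^ ((3 : ℝ) / 2) * |Real.Gamma (-γ)|)

/-- The kernel
`K_γ(ρ) = C(3,γ) (sinh ρ)⁻¹ ρ^{−1/2−γ} · 2 K_{3/2+γ}(ρ) / (Γ(3/2+γ) 2^{3/2+γ})`. -/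
noncomputable def Kker (γ ρ : ℝ) : ℝ :=
  C3 γ * (Real.sinh ρ)⁻¹ * ρ ^ (-(1 / 2 : ℝ) - γ) * (2 * besselK (3 / 2 + γ) ρ) /
    (Real.Gamma (3 / 2 + γ) * 2 ^ ((3 : ℝ) / 2 + γ))

/-- Scale function `I_{0,γ}(R) = 4π ∫₀^R ρ² K_γ(ρ) sinh²ρ dρ`. -/
noncomputable def scaleI0 (γ R : ℝ) : ℝ :=
  4 * Real.pi * ∫ ρ in (0 : ℝ)..R, ρ ^ 2 * Kker γ ρ * (Real.sinh ρ) ^ 2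

/-- Scale function `I_{∞,γ}(R) = 4π R² ∫_R^∞ K_γ(ρ) sinh²ρ dρ`. -/
noncomputable def scaleIinf (γ R : ℝ) : ℝ :=
  4 * Real.pi * R ^ 2 * ∫ ρ in Set.Ioi R, Kker γ ρ * (Real.sinh ρ) ^ 2

lemma cosh_ratio {ν μ s t : ℝ} (hμ : 0 ≤ μ) (hνμ : μ ≤ ν) (ht : 0 ≤ t) (hst : t ≤ s) :
    Real.cosh (ν * t) * Real.cosh (μ * s) ≤ Real.cosh (ν * s) * Real.cosh (μ * t) := by
  have key : ∀ a b : ℝ, Real.cosh a * Real.cosh b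
      = (Real.cosh (a + b) + Real.cosh (a - b)) / 2 := by
    intro a b
    rw [Real.cosh_add, Real.cosh_sub]; ring
  rw [key, key]
  have hν : 0 ≤ ν := hμ.trans hνμ
  have hs : 0 ≤ s := ht.trans hst
  have h1 : Real.cosh (ν * t + μ * s) ≤ Real.cosh (ν * s + μ * t) := by
    rw [Real.cosh_le_cosh, abs_of_nonneg (by positivity), abs_of_nonneg (by positivity)]
    nlinarith [mul_nonneg (sub_nonneg.2 hνμ) (sub_nonneg.2 hst)]
  have h2 : Real.cosh (ν * t - μ * s) ≤ Real.cosh (ν * s - μ * t) := by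
    rw [Real.cosh_le_cosh]
    refine le_trans (abs_le.2 ⟨?_, ?_⟩) (le_abs_self _)
    · nlinarith [mul_nonneg (sub_nonneg.2 hνμ) (add_nonneg hs ht)]
    · nlinarith [mul_nonneg (add_nonneg hν hμ) (sub_nonneg.2 hst)]
  linarith

lemma exp_neg_bound {p u : ℝ} (hp : 0 < p) (hu : 0 < u) :
    Real.exp (-u) ≤ p ^ p * u ^ (-p) := by
  have h1 : u / p ≤ Real.exp (u / p) := by linarith [Real.add_one_le_exp (u / p)]
  have h2 : (u / p) ^ p ≤ Real.exp u := by
    calc (u / p) ^ p ≤ (Real.exp (u / p)) ^ p :=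
          Real.rpow_le_rpow (by positivity) h1 hp.le
      _ = Real.exp u := by
          rw [← Real.exp_mul]; congr 1; field_simp
  rw [Real.div_rpow hu.le hp.le, div_le_iff₀ (by positivity)] at h2
  rw [Real.exp_neg, Real.rpow_neg hu.le, ← div_eq_mul_inv, inv_eq_one_div,
    div_le_div_iff₀ (Real.exp_pos _) (by positivity)]
  linarith

lemma integrand_bound {ν p x s : ℝ} (hν : 0 ≤ ν) (hp : 0 < p) (hx : 0 < x) (hs : 0 < s) :
    Real.exp (-x * Real.cosh s) * Real.cosh (ν * s)
      ≤ p ^ p * 2 ^ p * x ^ (-p) * Real.exp ((ν - p) * s) := by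
  have h1 : Real.exp (-x * Real.cosh s) ≤ p ^ p * (x * Real.exp s / 2) ^ (-p) := by
    refine le_trans (Real.exp_le_exp.2 ?_) (exp_neg_bound hp (by positivity))
    rw [Real.cosh_eq]
    nlinarith [mul_pos hx (Real.exp_pos (-s))]
  have h2 : Real.cosh (ν * s) ≤ Real.exp (ν * s) := by
    rw [Real.cosh_eq]
    have : Real.exp (-(ν * s)) ≤ Real.exp (ν * s) :=
      Real.exp_le_exp.2 (by nlinarith [mul_nonneg hν hs.le])
    linarith
  calc _ ≤ (p ^ p * (x * Real.exp s / 2) ^ (-p)) * Real.exp (ν * s) := by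
        gcongr
    _ = _ := by
      rw [Real.div_rpow (by positivity) (by norm_num), Real.mul_rpow hx.le (Real.exp_pos _).le,
        ← Real.exp_mul, Real.rpow_neg (show (0:ℝ) ≤ 2 by norm_num), div_inv_eq_mul]
      rw [show (ν - p) * s = s * -p + ν * s by ring, Real.exp_add]
      ring

lemma besselK_integrable {ν x : ℝ} (hν : 0 ≤ ν) (hx : 0 < x) :
    IntegrableOn (fun s => Real.exp (-x * Real.cosh s) * Real.cosh (ν * s)) (Set.Ioi 0) := by
  have hg := (integrableOn_exp_mul_Ioi (a := ν - (ν + 1)) (by linarith) 0).const_mul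
    ((ν + 1) ^ (ν + 1) * 2 ^ (ν + 1) * x ^ (-(ν + 1)))
  refine Integrable.mono' hg ?_ ?_
  · exact (by fun_prop : Continuous fun s : ℝ =>
      Real.exp (-x * Real.cosh s) * Real.cosh (ν * s)).aestronglyMeasurable
  · refine (ae_restrict_iff' measurableSet_Ioi).2 (Filter.Eventually.of_forall fun s hs => ?_)
    rw [Real.norm_of_nonneg (mul_nonneg (Real.exp_pos _).le (Real.cosh_pos _).le)]
    exact integrand_bound hν (by linarith) hx hs

lemma besselK_bound {ν p x : ℝ} (hν : 0 ≤ ν) (hp : ν < p) (hx : 0 < x) :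
    besselK ν x ≤ p ^ p * 2 ^ p * x ^ (-p) * (1 / (p - ν)) := by
  have hg := (integrableOn_exp_mul_Ioi (a := ν - p) (by linarith) 0).const_mul
    (p ^ p * 2 ^ p * x ^ (-p))
  have h : besselK ν x ≤ ∫ s in Set.Ioi (0:ℝ),
      p ^ p * 2 ^ p * x ^ (-p) * Real.exp ((ν - p) * s) :=
    setIntegral_mono_on (besselK_integrable hν hx) hg measurableSet_Ioi
      fun s hs => integrand_bound hν (hν.trans_lt hp) hx hs
  rw [integral_const_mul, integral_exp_mul_Ioi (by linarith)] at h
  convert h using 2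
  rw [mul_zero, Real.exp_zero, show ν - p = -(p - ν) by ring, neg_div_neg_eq]

lemma besselK_nonneg (ν x : ℝ) : 0 ≤ besselK ν x :=
  integral_nonneg fun _ => mul_nonneg (Real.exp_pos _).le (Real.cosh_pos _).le

lemma besselK_cross {ν μ x y : ℝ} (hμ : 0 ≤ μ) (hνμ : μ ≤ ν) (hx : 0 < x) (hxy : x ≤ y) :
    besselK ν y * besselK μ x ≤ besselK ν x * besselK μ y := by
  have hν : 0 ≤ ν := hμ.trans hνμ
  have hy : 0 < y := hx.trans_le hxy
  set k : ℝ → ℝ → ℝ → ℝ := fun ν x s => Real.exp (-x * Real.cosh s) * Real.cosh (ν * s) with hk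
  have hK : ∀ ν x, besselK ν x = ∫ s in Set.Ioi (0:ℝ), k ν x s := fun _ _ => rfl
  set m : Measure ℝ := volume.restrict (Set.Ioi (0:ℝ)) with hm
  have I1 : Integrable (k ν x) m := besselK_integrable hν hx
  have I2 : Integrable (k ν y) m := besselK_integrable hν hy
  have I3 : Integrable (k μ x) m := besselK_integrable hμ hx
  have I4 : Integrable (k μ y) m := besselK_integrable hμ hy
  have E : ∫ z, ((k ν x z.1 * k μ y z.2 - k ν y z.1 * k μ x z.2)
      - (k μ x z.1 * k ν y z.2 - k μ y z.1 * k ν x z.2)) ∂(m.prod m)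
      = (besselK ν x * besselK μ y - besselK ν y * besselK μ x)
        - (besselK μ x * besselK ν y - besselK μ y * besselK ν x) := by
    have P1 : Integrable (fun z : ℝ × ℝ => k ν x z.1 * k μ y z.2 - k ν y z.1 * k μ x z.2)
      (m.prod m) := (I1.mul_prod I4).sub (I2.mul_prod I3)
    have P2 : Integrable (fun z : ℝ × ℝ => k μ x z.1 * k ν y z.2 - k μ y z.1 * k ν x z.2)
      (m.prod m) := (I3.mul_prod I2).sub (I4.mul_prod I1)
    rw [integral_sub P1 P2,
      integral_sub (I1.mul_prod I4) (I2.mul_prod I3),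
      integral_sub (I3.mul_prod I2) (I4.mul_prod I1),
      integral_prod_mul, integral_prod_mul, integral_prod_mul, integral_prod_mul]
    simp only [hK]
  have hpos : 0 ≤ ∫ z, ((k ν x z.1 * k μ y z.2 - k ν y z.1 * k μ x z.2)
      - (k μ x z.1 * k ν y z.2 - k μ y z.1 * k ν x z.2)) ∂(m.prod m) := by
    rw [hm, Measure.prod_restrict]
    refine setIntegral_nonneg (measurableSet_Ioi.prod measurableSet_Ioi) ?_
    rintro ⟨s, t⟩ ⟨hs, ht⟩
    simp only [Set.mem_Ioi] at hs ht
    have aux : ∀ s t : ℝ, 0 < t → t ≤ s →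
        0 ≤ (Real.cosh (ν * s) * Real.cosh (μ * t) - Real.cosh (ν * t) * Real.cosh (μ * s)) *
          (Real.exp (-x * Real.cosh s) * Real.exp (-y * Real.cosh t)
            - Real.exp (-y * Real.cosh s) * Real.exp (-x * Real.cosh t)) := by
      intro s t ht hst
      refine mul_nonneg (sub_nonneg.2 (cosh_ratio hμ hνμ ht.le hst)) (sub_nonneg.2 ?_)
      rw [← Real.exp_add, ← Real.exp_add, Real.exp_le_exp]
      have : Real.cosh t ≤ Real.cosh s := by
        rw [Real.cosh_le_cosh, abs_of_pos ht, abs_of_pos (ht.trans_le hst)]; exact hst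
      nlinarith [mul_nonneg (sub_nonneg.2 hxy) (sub_nonneg.2 this)]
    simp only [hk]
    rcases le_total t s with h | h
    · have := aux s t ht h
      linarith
    · have := aux t s hs h
      linarith
  rw [E] at hpos
  linarith

lemma besselK_three_half {x : ℝ} (hx : 0 < x) :
    besselK (3 / 2) x = Real.exp (-x) * √(Real.pi / (2 * x)) * (1 + 1 / x) := by
  have himg : (fun s : ℝ => Real.sinh (s / 2)) '' Set.Ioi 0 = Set.Ioi 0 := by
    ext u
    constructor
    · rintro ⟨s, hs, rfl⟩
      have : 0 < s := hs
      exact Real.sinh_pos_iff.2 (by linarith)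
    · intro hu
      refine ⟨2 * Real.arsinh u, ?_, ?_⟩
      · have : 0 < Real.arsinh u := Real.arsinh_pos_iff.2 hu
        exact mul_pos two_pos this
      · simp
  have hsub := integral_image_eq_integral_abs_deriv_smul (s := Set.Ioi (0:ℝ)) measurableSet_Ioi
    (f := fun s : ℝ => Real.sinh (s / 2)) (f' := fun s => Real.cosh (s / 2) * (1 / 2))
    (fun s _ => by
      have := (Real.hasDerivAt_sinh (s / 2)).comp s ((hasDerivAt_id s).div_const 2)
      exact this.hasDerivWithinAt)
    (fun a _ b _ hab => by
      have := Real.sinh_injective hab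
      linarith)
    (fun u => 2 * Real.exp (-x) * (Real.exp (-(2 * x) * u ^ 2)
      + 4 * (u ^ (2:ℝ) * Real.exp (-(2 * x) * u ^ (2:ℝ)))))
  rw [himg] at hsub
  have h1 : besselK (3 / 2) x = ∫ u in Set.Ioi (0:ℝ), 2 * Real.exp (-x) *
      (Real.exp (-(2 * x) * u ^ 2) + 4 * (u ^ (2:ℝ) * Real.exp (-(2 * x) * u ^ (2:ℝ)))) := by
    rw [hsub]
    refine integral_congr_ae (Filter.Eventually.of_forall fun s => ?_)
    simp only [smul_eq_mul, Real.rpow_two]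
    rw [abs_of_pos (by have := Real.cosh_pos (s / 2); positivity)]
    have e1 : Real.cosh s = 1 + 2 * Real.sinh (s / 2) ^ 2 := by
      have := Real.cosh_two_mul (s / 2)
      rw [mul_div_cancel₀ s two_ne_zero, Real.cosh_sq] at this
      linarith
    have e2 : Real.cosh (3 / 2 * s) = Real.cosh (s / 2) * (1 + 4 * Real.sinh (s / 2) ^ 2) := by
      rw [show 3 / 2 * s = 3 * (s / 2) by ring, Real.cosh_three_mul]
      have := Real.cosh_sq (s / 2)
      linear_combination 4 * Real.cosh (s / 2) * this
    rw [e1, e2, show -x * (1 + 2 * Real.sinh (s / 2) ^ 2)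
      = -x + -(2 * x) * Real.sinh (s / 2) ^ 2 by ring, Real.exp_add]
    ring
  have hb : 0 < 2 * x := by positivity
  have J1 : IntegrableOn (fun u : ℝ => Real.exp (-(2 * x) * u ^ 2)) (Set.Ioi 0) :=
    (integrable_exp_neg_mul_sq hb).integrableOn
  have J2 : IntegrableOn (fun u : ℝ => u ^ (2:ℝ) * Real.exp (-(2 * x) * u ^ (2:ℝ))) (Set.Ioi 0) :=
    integrableOn_rpow_mul_exp_neg_mul_rpow (by norm_num) (by norm_num) hb
  have G : Real.Gamma ((2 + 1) / 2) = √Real.pi / 2 := by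
    rw [show ((2:ℝ) + 1) / 2 = 1 / 2 + 1 by norm_num, Real.Gamma_add_one (by norm_num),
      Real.Gamma_one_half_eq]
    ring
  rw [h1, integral_const_mul, integral_add J1 (J2.const_mul 4), integral_const_mul,
    integral_gaussian_Ioi, integral_rpow_mul_exp_neg_mul_rpow (by norm_num) (by norm_num) hb, G,
    show (-((2:ℝ) + 1) / 2) = -1 + -(1 / 2) by norm_num, Real.rpow_add hb, Real.rpow_neg_one,
    Real.rpow_neg hb.le, ← Real.sqrt_eq_rpow, Real.sqrt_div Real.pi_pos.le]
  have : √(2 * x) ≠ 0 := (Real.sqrt_pos.2 hb).ne'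
  field_simp
  ring

lemma phi_antitone :
    AntitoneOn (fun x : ℝ => (1 - Real.exp (-(2 * x))) * (1 + 1 / x)) (Set.Ioi 0) := by
  have hd : ∀ x ∈ Set.Ioi (0:ℝ), HasDerivAt
      (fun x : ℝ => (1 - Real.exp (-(2 * x))) * (1 + 1 / x))
      (2 * Real.exp (-(2 * x)) * (1 + 1 / x) + (1 - Real.exp (-(2 * x))) * (-1 / x ^ 2)) x := by
    intro x hx
    have hx0 : x ≠ 0 := ne_of_gt hx
    have a0 : HasDerivAt (fun x : ℝ => -(2 * x)) (-(2 * 1)) x :=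
      ((hasDerivAt_id x).const_mul 2).neg
    have a1 : HasDerivAt (fun x : ℝ => 1 - Real.exp (-(2 * x)))
      (-(Real.exp (-(2 * x)) * (-(2 * 1)))) x := a0.exp.const_sub 1
    have a2 : HasDerivAt (fun x : ℝ => 1 + x⁻¹) (-(x ^ 2)⁻¹) x :=
      (hasDerivAt_inv hx0).const_add 1
    have a3 := a1.fun_mul a2
    simp only [one_div]
    refine a3.congr_deriv ?_
    field_simp
    try ring
  refine antitoneOn_of_deriv_nonpos (convex_Ioi 0) (fun x hx => (hd x hx).continuousAt.continuousWithinAt)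
    (fun x hx => ?_) (fun x hx => ?_)
  · rw [interior_Ioi] at hx
    exact (hd x hx).differentiableAt.differentiableWithinAt
  · rw [interior_Ioi] at hx
    rw [(hd x hx).deriv]
    have hx0 : 0 < x := hx
    have h1 := Real.quadratic_le_exp_of_nonneg (show 0 ≤ 2 * x by positivity)
    have h2 : Real.exp (-(2 * x)) * Real.exp (2 * x) = 1 := by
      rw [← Real.exp_add]; simp
    have h3 := mul_le_mul_of_nonneg_left h1 (Real.exp_pos (-(2 * x))).le
    rw [h2] at h3
    have : 2 * Real.exp (-(2 * x)) * (1 + 1 / x) + (1 - Real.exp (-(2 * x))) * (-1 / x ^ 2)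
      = (Real.exp (-(2 * x)) * (1 + 2 * x + (2 * x) ^ 2 / 2) - 1) / x ^ 2 := by
      field_simp
      ring
    rw [this]
    exact div_nonpos_of_nonpos_of_nonneg (by linarith) (by positivity)

lemma h_three_half {x : ℝ} (hx : 0 < x) :
    √x * Real.sinh x * besselK (3 / 2) x
      = √(Real.pi / 2) / 2 * ((1 - Real.exp (-(2 * x))) * (1 + 1 / x)) := by
  rw [besselK_three_half hx, Real.sinh_eq, show Real.pi / (2 * x) = Real.pi / 2 / x by field_simp,
    Real.sqrt_div (by positivity), show -(2 * x) = -x + -x by ring, Real.exp_add]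
  have : √x ≠ 0 := (Real.sqrt_pos.2 hx).ne'
  have h2 : Real.exp (-x) * Real.exp x = 1 := by
    rw [← Real.exp_add]; simp
  field_simp
  linear_combination h2

lemma besselK_three_half_pos {x : ℝ} (hx : 0 < x) : 0 < besselK (3 / 2) x := by
  rw [besselK_three_half hx]
  have := Real.pi_pos
  positivity

lemma h_antitone {ν : ℝ} (hν : 3 / 2 ≤ ν) :
    AntitoneOn (fun x : ℝ => √x * Real.sinh x * besselK ν x) (Set.Ioi 0) := by
  intro x hx y hy hxy
  have hx0 : 0 < x := hx
  have hy0 : 0 < y := hy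
  have hc := besselK_cross (by norm_num) hν hx0 hxy
  have hp : √y * Real.sinh y * besselK (3 / 2) y ≤ √x * Real.sinh x * besselK (3 / 2) x := by
    rw [h_three_half hx0, h_three_half hy0]
    exact mul_le_mul_of_nonneg_left (phi_antitone hx hy hxy) (by positivity)
  have kx := besselK_three_half_pos hx0
  have ky := besselK_three_half_pos hy0
  have hsy : 0 ≤ √y * Real.sinh y := mul_nonneg (Real.sqrt_nonneg _) (Real.sinh_nonneg_iff.2 hy0.le)
  refine le_of_mul_le_mul_right ?_ (mul_pos kx ky)
  calc √y * Real.sinh y * besselK ν y * (besselK (3/2) x * besselK (3/2) y)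
      = √y * Real.sinh y * besselK (3/2) y * (besselK ν y * besselK (3/2) x) := by ring
    _ ≤ √x * Real.sinh x * besselK (3/2) x * (besselK ν x * besselK (3/2) y) := by
        refine mul_le_mul hp hc (mul_nonneg (besselK_nonneg _ _) kx.le) ?_
        exact le_trans (mul_nonneg hsy ky.le) hp
    _ = _ := by ring

lemma sinh_le_mul_cosh {x : ℝ} (hx : 0 ≤ x) : Real.sinh x ≤ x * Real.cosh x := by
  have h : MonotoneOn (fun x : ℝ => x * Real.cosh x - Real.sinh x) (Set.Ici 0) := by
    refine monotoneOn_of_deriv_nonneg (convex_Ici 0) (by fun_prop) (by fun_prop) fun y hy => ?_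
    rw [interior_Ici] at hy
    have : HasDerivAt (fun x : ℝ => x * Real.cosh x - Real.sinh x)
      (1 * Real.cosh y + y * Real.sinh y - Real.cosh y) y :=
      ((hasDerivAt_id y).mul (Real.hasDerivAt_cosh y)).sub (Real.hasDerivAt_sinh y)
    rw [this.deriv]
    have hy0 : 0 < y := hy
    nlinarith [mul_pos hy0 (Real.sinh_pos_iff.2 hy0)]
  have := h (Set.mem_Ici.2 le_rfl) (Set.mem_Ici.2 hx) hx
  simp at this
  linarith

lemma h_integrable {γ R : ℝ} (hγ : γ ∈ Set.Ioo (0 : ℝ) 1) (hR : 0 < R) :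
    IntervalIntegrable (fun t => t ^ (1 - γ) *
      (√(R * t) * Real.sinh (R * t) * besselK (3 / 2 + γ) (R * t))) volume 0 1 := by
  obtain ⟨h0, h1⟩ := hγ
  rw [intervalIntegrable_iff_integrableOn_Ioc_of_le zero_le_one]
  have hmain : AntitoneOn (fun t => √(R * t) * Real.sinh (R * t) * besselK (3 / 2 + γ) (R * t))
      (Set.Ioc 0 1) := by
    intro a ha b hb hab
    exact h_antitone (by linarith) (mul_pos hR ha.1) (mul_pos hR hb.1)
      (mul_le_mul_of_nonneg_left hab hR.le)
  set D : ℝ := (5/2 : ℝ) ^ (5/2 : ℝ) * 2 ^ (5/2 : ℝ) * (1 / (5/2 - (3/2 + γ))) with hD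
  have hD0 : 0 ≤ D := by
    have : 0 < 5/2 - (3/2 + γ) := by linarith
    positivity
  have hg : IntegrableOn (fun t : ℝ => D * Real.cosh R * R⁻¹ * t ^ (-γ)) (Set.Ioc 0 1) := by
    have := (intervalIntegral.intervalIntegrable_rpow' (a := 0) (b := 1) (r := -γ) (by linarith))
    rw [intervalIntegrable_iff_integrableOn_Ioc_of_le zero_le_one] at this
    exact this.const_mul _
  refine Integrable.mono' hg ?_ ?_
  · refine AEStronglyMeasurable.mul ?_ ?_
    · exact (by fun_prop : Measurable fun t : ℝ => t ^ (1 - γ)).aestronglyMeasurable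
    · exact (aemeasurable_restrict_of_antitoneOn measurableSet_Ioc hmain).aestronglyMeasurable
  · refine (ae_restrict_iff' measurableSet_Ioc).2 (Filter.Eventually.of_forall fun t ht => ?_)
    have ht0 : 0 < t := ht.1
    have hz : 0 < R * t := mul_pos hR ht0
    have hsn : 0 ≤ Real.sinh (R * t) := Real.sinh_nonneg_iff.2 hz.le
    have hKn := besselK_nonneg (3/2 + γ) (R * t)
    rw [Real.norm_of_nonneg (by positivity)]
    have hK := besselK_bound (ν := 3/2 + γ) (p := 5/2) (by linarith) (by linarith) hz
    have hK' : besselK (3/2 + γ) (R * t) ≤ D * (R * t) ^ (-(5/2) : ℝ) := by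
      rw [hD]; linarith
    have hs : Real.sinh (R * t) ≤ (R * t) * Real.cosh R := by
      refine (sinh_le_mul_cosh hz.le).trans (mul_le_mul_of_nonneg_left ?_ hz.le)
      rw [Real.cosh_le_cosh, abs_of_pos hz, abs_of_pos hR]
      nlinarith [ht.2]
    have hc := Real.cosh_pos R
    calc t ^ (1 - γ) * (√(R * t) * Real.sinh (R * t) * besselK (3 / 2 + γ) (R * t))
        ≤ t ^ (1 - γ) * (√(R * t) * ((R * t) * Real.cosh R) * (D * (R * t) ^ (-(5/2) : ℝ))) := by
          gcongr
      _ = D * Real.cosh R * t ^ (1 - γ) * ((R * t) ^ (1/2 : ℝ) * (R * t) ^ (1 : ℝ)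
            * (R * t) ^ (-(5/2) : ℝ)) := by
          rw [Real.sqrt_eq_rpow, Real.rpow_one]; ring
      _ = D * Real.cosh R * t ^ (1 - γ) * (R * t)⁻¹ := by
          rw [← Real.rpow_add hz, ← Real.rpow_add hz, ← Real.rpow_neg_one]; norm_num
      _ = D * Real.cosh R * R⁻¹ * t ^ (-γ) := by
          rw [show -γ = (1 - γ) + (-1) by ring, Real.rpow_add ht0, Real.rpow_neg_one, mul_inv]
          ring

lemma scaleI0_eq {γ R : ℝ} (hR : 0 < R) :
    scaleI0 γ R / R ^ (2 - γ) = 4 * Real.pi *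
      (C3 γ * 2 / (Real.Gamma (3 / 2 + γ) * 2 ^ ((3 : ℝ) / 2 + γ))) *
      ∫ t in (0:ℝ)..1, t ^ (1 - γ) *
        (√(R * t) * Real.sinh (R * t) * besselK (3 / 2 + γ) (R * t)) := by
  set A := C3 γ * 2 / (Real.Gamma (3 / 2 + γ) * 2 ^ ((3 : ℝ) / 2 + γ)) with hA
  have hsub := intervalIntegral.mul_integral_comp_mul_left (a := 0) (b := 1)
    (f := fun ρ => ρ ^ 2 * Kker γ ρ * (Real.sinh ρ) ^ 2) R
  rw [mul_zero, mul_one] at hsub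
  have hcongr : ∫ t in (0:ℝ)..1, (R * t) ^ 2 * Kker γ (R * t) * (Real.sinh (R * t)) ^ 2
      = ∫ t in (0:ℝ)..1, (A * R ^ (1 - γ)) * (t ^ (1 - γ) *
        (√(R * t) * Real.sinh (R * t) * besselK (3 / 2 + γ) (R * t))) := by
    refine intervalIntegral.integral_congr_uIoo fun t ht => ?_
    rw [Set.uIoo_of_le zero_le_one] at ht
    have ht0 : 0 < t := ht.1
    have hz : 0 < R * t := mul_pos hR ht0
    have hs : Real.sinh (R * t) ≠ 0 := (Real.sinh_pos_iff.2 hz).ne'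
    have e : (R * t) ^ 2 * (R * t) ^ (-(1 / 2 : ℝ) - γ) = R ^ (1 - γ) * t ^ (1 - γ) * √(R * t) := by
      rw [← Real.mul_rpow hR.le ht0.le, Real.sqrt_eq_rpow, ← Real.rpow_two, ← Real.rpow_add hz,
        ← Real.rpow_add hz]
      congr 1; ring
    simp only [Kker]
    calc _ = A * ((R * t) ^ 2 * (R * t) ^ (-(1 / 2 : ℝ) - γ)) * besselK (3 / 2 + γ) (R * t)
          * ((Real.sinh (R * t))⁻¹ * Real.sinh (R * t)) * Real.sinh (R * t) := by rw [hA]; ring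
      _ = _ := by rw [e, inv_mul_cancel₀ hs]; ring
  rw [scaleI0, ← hsub, hcongr, intervalIntegral.integral_const_mul,
    show (2:ℝ) - γ = 1 + (1 - γ) by ring, Real.rpow_add hR, Real.rpow_one]
  have : R ^ (1 - γ) ≠ 0 := (Real.rpow_pos_of_pos hR _).ne'
  field_simp

/-- Lemma 5.2: `R ↦ I_{0,γ}(R)/R^{2−γ}` is non-increasing on `(0,∞)`. -/
theorem scaleI0_div_rpow_antitone (γ : ℝ) (hγ : γ ∈ Set.Ioo (0 : ℝ) 1) :
    AntitoneOn (fun R : ℝ => scaleI0 γ R / R ^ ((2 : ℝ) - γ)) (Set.Ioi 0) := by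
  intro R hR S hS hRS
  have hR0 : 0 < R := hR
  have hS0 : 0 < S := hS
  have hG : 0 < Real.Gamma (3 / 2 + γ) := Real.Gamma_pos_of_pos (by linarith [hγ.1])
  have hC : 0 ≤ C3 γ := by
    unfold C3
    have := Real.pi_pos
    positivity
  simp only
  rw [scaleI0_eq hR0, scaleI0_eq hS0]
  have := Real.pi_pos
  refine mul_le_mul_of_nonneg_left ?_ (by positivity)
  refine intervalIntegral.integral_mono_on_of_le_Ioo zero_le_one (h_integrable hγ hS0)
    (h_integrable hγ hR0) fun t ht => ?_
  refine mul_le_mul_of_nonneg_left ?_ (Real.rpow_nonneg ht.1.le _)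
  exact h_antitone (by linarith [hγ.1]) (mul_pos hR0 ht.1) (mul_pos hS0 ht.1)
    (mul_le_mul_of_nonneg_right hRS ht.1.le)
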